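/- arXiv:1912.10358 — 5 statements merged into one kernel-verified Lean document; each statement's English description precedes it below -/
import Mathlib

section
/- There exists an absolute constant C > 0 such that for all t > 0 and all β ∈ ℝ: ∫₀^∞ e^{−8t·v²}·|v − β|^{−1/2} dv ≤ C·t^{−1/4}. -/
open MeasureTheory Real

/-- The function `r ↦ r ^ (-1 / 2)` cut off at `r ≤ δ`. -/
noncomputable def truncatedInvSqrt (δ : ℝ) : ℝ → ℝ :=
  (Set.Iic δ).indicator fun r => r ^ (-(1 : ℝ) / 2)

theorem setIntegral_truncatedInvSqrt {δ : ℝ} (hδ : 0 < δ) :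
    ∫ r in Set.Ioi 0, truncatedInvSqrt δ r = 2 * δ ^ ((1 : ℝ) / 2) := by
  rw [truncatedInvSqrt, setIntegral_indicator measurableSet_Iic, Set.Ioi_inter_Iic,
    ← intervalIntegral.integral_of_le hδ.le, integral_rpow (Or.inl (by norm_num))]
  norm_num
  ring

theorem integral_truncatedInvSqrt_abs {δ : ℝ} (hδ : 0 < δ) :
    ∫ v : ℝ, truncatedInvSqrt δ |v| = 4 * δ ^ ((1 : ℝ) / 2) := by
  rw [integral_comp_abs, setIntegral_truncatedInvSqrt hδ]
  ring

theorem integrable_truncatedInvSqrt_abs {δ : ℝ} (hδ : 0 < δ) :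
    Integrable fun v : ℝ => truncatedInvSqrt δ |v| := by
  refine .of_integral_ne_zero ?_
  rw [integral_truncatedInvSqrt_abs hδ]
  positivity

theorem exp_mul_rpow_le {δ s : ℝ} (hδ : 0 < δ) (hs : 0 ≤ s) {r : ℝ} (hr : 0 ≤ r) :
    rexp (-s) * r ^ (-(1 : ℝ) / 2) ≤
      truncatedInvSqrt δ r + δ ^ (-(1 : ℝ) / 2) * rexp (-s) := by
  by_cases h : r ≤ δ
  · rw [truncatedInvSqrt, Set.indicator_of_mem (Set.mem_Iic.2 h)]
    have h1 : rexp (-s) * r ^ (-(1 : ℝ) / 2) ≤ 1 * r ^ (-(1 : ℝ) / 2) := by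
      gcongr
      exact exp_le_one_iff.2 (by linarith)
    have h2 : 0 ≤ δ ^ (-(1 : ℝ) / 2) * rexp (-s) := by positivity
    linarith
  · rw [truncatedInvSqrt, Set.indicator_of_notMem (by simpa using h), zero_add, mul_comm]
    gcongr ?_ * _
    exact rpow_le_rpow_of_nonpos hδ (not_le.1 h).le (by norm_num)

theorem stmt_13 :
    ∃ C > (0 : ℝ), ∀ t : ℝ, 0 < t → ∀ β : ℝ,
      (∫ v in Set.Ioi (0 : ℝ), Real.exp (-8 * t * v ^ 2) * |v - β| ^ (-(1 : ℝ) / 2)) ≤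
        C * t ^ (-(1 : ℝ) / 4) := by
  refine ⟨4 + √(π / 8), by positivity, fun t ht β => ?_⟩
  set δ := t ^ (-(1 : ℝ) / 2) with hδ_def
  have hδ : 0 < δ := by positivity
  have hk : Integrable fun v : ℝ => truncatedInvSqrt δ |v - β| :=
    (integrable_truncatedInvSqrt_abs hδ).comp_sub_right β
  have hg : Integrable fun v : ℝ => δ ^ (-(1 : ℝ) / 2) * rexp (-(8 * t) * v ^ 2) :=
    (integrable_exp_neg_mul_sq (by positivity)).const_mul _
  have hle : ∀ v : ℝ, rexp (-8 * t * v ^ 2) * |v - β| ^ (-(1 : ℝ) / 2) ≤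
      truncatedInvSqrt δ |v - β| + δ ^ (-(1 : ℝ) / 2) * rexp (-(8 * t) * v ^ 2) := fun v => by
    have := exp_mul_rpow_le hδ (s := 8 * t * v ^ 2) (by positivity) (abs_nonneg (v - β))
    simpa only [neg_mul] using this
  have hnonneg : ∀ v : ℝ, 0 ≤ rexp (-8 * t * v ^ 2) * |v - β| ^ (-(1 : ℝ) / 2) :=
    fun v => by positivity
  have hδ₁ : δ ^ ((1 : ℝ) / 2) = t ^ (-(1 : ℝ) / 4) := by
    rw [hδ_def, ← rpow_mul ht.le]
    norm_num
  have hδ₂ : δ ^ (-(1 : ℝ) / 2) * √(π / (8 * t)) = √(π / 8) * t ^ (-(1 : ℝ) / 4) := by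
    rw [hδ_def, ← rpow_mul ht.le, ← div_div, sqrt_div (by positivity), sqrt_eq_rpow t,
      div_eq_mul_inv (√(π / 8)), ← rpow_neg ht.le, mul_left_comm, ← rpow_add ht]
    norm_num
  calc ∫ v in Set.Ioi (0 : ℝ), rexp (-8 * t * v ^ 2) * |v - β| ^ (-(1 : ℝ) / 2)
      ≤ ∫ v in Set.Ioi (0 : ℝ),
          (truncatedInvSqrt δ |v - β| + δ ^ (-(1 : ℝ) / 2) * rexp (-(8 * t) * v ^ 2)) :=
        integral_mono_of_nonneg (ae_of_all _ hnonneg) (hk.add hg).integrableOn (ae_of_all _ hle)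
    _ ≤ ∫ v : ℝ, (truncatedInvSqrt δ |v - β| + δ ^ (-(1 : ℝ) / 2) * rexp (-(8 * t) * v ^ 2)) :=
        setIntegral_le_integral (hk.add hg) (ae_of_all _ fun v => (hnonneg v).trans (hle v))
    _ = (4 + √(π / 8)) * t ^ (-(1 : ℝ) / 4) := by
        rw [integral_add hk hg, integral_sub_right_eq_self (fun v => truncatedInvSqrt δ |v|) β,
          integral_truncatedInvSqrt_abs hδ, integral_const_mul,
          integral_gaussian, hδ₁, hδ₂]
        ring
end

section
/- For each real p > 2, setting q = p/(p−1), there exists a constant C_p > 0 such that for all t > 0 and all β ∈ ℝ: ∫₀^∞ e^{−8t·v²}·v^{1/p − 1/2}·|v − β|^{1/q − 1} dv ≤ C_p·t^{−1/4}. -/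
open MeasureTheory Real

/-- Writing `m = min x y`, both factors are controlled by powers of `m`. -/
theorem exp_mul_rpow_mul_rpow_le {c a b x y : ℝ} (hc : 0 ≤ c) (ha : a ≤ 0) (hb : b < 0)
    (hx : 0 < x) (hy : 0 ≤ y) :
    exp (-c * x ^ 2) * x ^ a * y ^ b ≤
      x ^ (a + b) * exp (-c * x ^ 2) + y ^ (a + b) * exp (-c * y ^ 2) := by
  rcases hy.eq_or_lt with rfl | hy
  · rw [zero_rpow hb.ne, mul_zero]
    positivity
  rcases le_total x y with h | h
  · have h1 : y ^ b ≤ x ^ b := rpow_le_rpow_of_nonpos hx h hb.le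
    calc exp (-c * x ^ 2) * x ^ a * y ^ b ≤ exp (-c * x ^ 2) * x ^ a * x ^ b := by gcongr
      _ = x ^ (a + b) * exp (-c * x ^ 2) := by rw [rpow_add hx]; ring
      _ ≤ _ := le_add_of_nonneg_right (by positivity)
  · have h1 : x ^ a ≤ y ^ a := rpow_le_rpow_of_nonpos hy h ha
    have h2 : exp (-c * x ^ 2) ≤ exp (-c * y ^ 2) := by
      rw [neg_mul, neg_mul]
      gcongr
    calc exp (-c * x ^ 2) * x ^ a * y ^ b ≤ exp (-c * y ^ 2) * y ^ a * y ^ b := by gcongr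
      _ = y ^ (a + b) * exp (-c * y ^ 2) := by rw [rpow_add hy]; ring
      _ ≤ _ := le_add_of_nonneg_left (by positivity)

theorem integral_exp_mul_rpow_mul_abs_sub_rpow_le {c a b : ℝ} (hc : 0 < c) (ha : a ≤ 0)
    (hb : b < 0) (hab : -1 < a + b) (β : ℝ) :
    ∫ v in Set.Ioi (0 : ℝ), exp (-c * v ^ 2) * v ^ a * |v - β| ^ b ≤
      3 * ∫ v in Set.Ioi (0 : ℝ), v ^ (a + b) * exp (-c * v ^ 2) := by
  set f : ℝ → ℝ := fun v ↦ v ^ (a + b) * exp (-c * v ^ 2) with hf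
  have hfi : IntegrableOn f (Set.Ioi 0) := integrableOn_rpow_mul_exp_neg_mul_sq hc hab
  have habs : Integrable fun v : ℝ ↦ f |v| := by
    have hpos : IntegrableOn (fun v : ℝ ↦ f |v|) (Set.Ioi 0) :=
      hfi.congr_fun (fun v hv ↦ by rw [abs_of_pos hv]) measurableSet_Ioi
    have hneg : IntegrableOn (fun v : ℝ ↦ f |v|) (Set.Iic 0) := by
      have := (integrableOn_Ici_iff_integrableOn_Ioi (by finiteness)).2 hpos
      rw [← neg_zero] at this
      simpa using this.comp_neg_Iic
    rw [← integrableOn_univ, ← Set.Iic_union_Ioi (a := (0 : ℝ))]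
    exact hneg.union hpos
  have hshift : Integrable fun v : ℝ ↦ f |v - β| := habs.comp_sub_right β
  calc ∫ v in Set.Ioi (0 : ℝ), exp (-c * v ^ 2) * v ^ a * |v - β| ^ b
      ≤ ∫ v in Set.Ioi (0 : ℝ), (f v + f |v - β|) := by
        refine integral_mono_of_nonneg ?_ (hfi.add hshift.integrableOn) ?_
        · filter_upwards [self_mem_ae_restrict measurableSet_Ioi] with v hv
          have : (0 : ℝ) < v := hv
          simp only [Pi.zero_apply]
          positivity
        · filter_upwards [self_mem_ae_restrict measurableSet_Ioi] with v hv
          exact exp_mul_rpow_mul_rpow_le hc.le ha hb hv (abs_nonneg _)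
    _ = (∫ v in Set.Ioi (0 : ℝ), f v) + ∫ v in Set.Ioi (0 : ℝ), f |v - β| :=
        integral_add hfi hshift.integrableOn
    _ ≤ (∫ v in Set.Ioi (0 : ℝ), f v) + ∫ v, f |v - β| := by
        refine add_le_add_right ?_ _
        refine setIntegral_le_integral hshift (.of_forall fun v ↦ ?_)
        simp only [hf, Pi.zero_apply]
        positivity
    _ = 3 * ∫ v in Set.Ioi (0 : ℝ), f v := by
        rw [integral_sub_right_eq_self (fun v ↦ f |v|) β, integral_comp_abs]
        ring

theorem stmt_15 (p : ℝ) (hp : 2 < p) :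
    ∃ C > (0 : ℝ), ∀ t : ℝ, 0 < t → ∀ β : ℝ,
      (∫ v in Set.Ioi (0 : ℝ),
          Real.exp (-8 * t * v ^ 2) * v ^ (1 / p - 1 / 2) *
            |v - β| ^ (1 / (p / (p - 1)) - 1)) ≤
        C * t ^ (-(1 : ℝ) / 4) := by
  have hp0 : 0 < p := by linarith
  have hb : 1 / (p / (p - 1)) - 1 = -(1 / p) := by
    rw [one_div_div]
    field_simp
    ring
  have ha : 1 / p - 1 / 2 ≤ 0 := sub_nonpos.2 (one_div_le_one_div_of_le two_pos hp.le)
  have hp' : 0 < 1 / p := by positivity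
  have hab : 1 / p - 1 / 2 + -(1 / p) = -1 / 2 := by ring
  have hG : 0 < Gamma (1 / 4) := Gamma_pos_of_pos (by norm_num)
  refine ⟨3 * (8 ^ (-(1 : ℝ) / 4) * (1 / 2) * Gamma (1 / 4)), by positivity, fun t ht β ↦ ?_⟩
  have key := integral_exp_mul_rpow_mul_abs_sub_rpow_le (c := 8 * t) (by positivity) ha
    (neg_lt_zero.2 hp') (by rw [hab]; norm_num) β
  have hI := integral_rpow_mul_exp_neg_mul_rpow (p := 2) (q := -1 / 2) (b := 8 * t) two_pos
    (by norm_num) (by positivity)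
  simp only [rpow_two] at hI
  rw [hab, hI, mul_rpow (by norm_num) ht.le] at key
  rw [hb]
  norm_num at key ⊢
  linarith
end

section
/- There exists an absolute constant C > 0 with the following property: for every measurable f : ℂ → ℂ such that M := sup_{v > 0} (∫_ℝ |f(u + iv)|² du)^{1/2} is finite, and for every t > 0 and every z ∈ ℂ: ∫₀^∞ ∫_v^∞ |f(u + iv)|·e^{−8t·u·v}·|u + iv − z|^{−1} du dv ≤ C·M·t^{−1/4}. -/
open MeasureTheory Real Complex

theorem inv_sq_add_sq_eq {c : ℝ} (hc : c ≠ 0) (x : ℝ) :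
    (x ^ 2 + c ^ 2)⁻¹ = (c ^ 2)⁻¹ * (1 + (x / c) ^ 2)⁻¹ := by
  rw [← mul_inv]
  congr 1
  field_simp
  ring

theorem integrable_inv_sq_add_sq {c : ℝ} (hc : c ≠ 0) :
    Integrable fun x : ℝ => (x ^ 2 + c ^ 2)⁻¹ := by
  simp_rw [inv_sq_add_sq_eq hc]
  exact (integrable_inv_one_add_sq.comp_div hc).const_mul _

theorem integral_univ_inv_sq_add_sq {c : ℝ} (hc : c ≠ 0) :
    ∫ x : ℝ, (x ^ 2 + c ^ 2)⁻¹ = π * |c|⁻¹ := by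
  simp_rw [inv_sq_add_sq_eq hc]
  rw [integral_const_mul, Measure.integral_comp_div (fun x : ℝ => (1 + x ^ 2)⁻¹),
    integral_univ_inv_one_add_sq, smul_eq_mul, ← sq_abs c]
  have := abs_pos.2 hc
  field_simp

theorem norm_inv_sq_eq (z : ℂ) (v u : ℝ) :
    ‖(u : ℂ) + (v : ℂ) * Complex.I - z‖⁻¹ ^ 2 = ((u - z.re) ^ 2 + (v - z.im) ^ 2)⁻¹ := by
  rw [inv_pow, Complex.sq_norm, Complex.normSq_apply]
  simp [pow_two]

/-- Cauchy–Schwarz along a horizontal line against the Cauchy kernel. -/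
theorem integral_norm_mul_cauchyKernel_le {f : ℂ → ℂ} (hf : Measurable f) {M : ℝ} (hM : 0 ≤ M)
    {v : ℝ} (hv : eLpNorm (fun u : ℝ => f ((u : ℂ) + (v : ℂ) * Complex.I)) 2 volume
      ≤ ENNReal.ofReal M) {z : ℂ} (hz : v ≠ z.im) :
    Integrable (fun u : ℝ => ‖f ((u : ℂ) + (v : ℂ) * Complex.I)‖ *
        ‖(u : ℂ) + (v : ℂ) * Complex.I - z‖⁻¹) ∧
      ∫ u : ℝ, ‖f ((u : ℂ) + (v : ℂ) * Complex.I)‖ * ‖(u : ℂ) + (v : ℂ) * Complex.I - z‖⁻¹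
        ≤ M * (√π * |v - z.im| ^ (-(1 : ℝ) / 2)) := by
  have hc : v - z.im ≠ 0 := sub_ne_zero.2 hz
  have hF : MemLp (fun u : ℝ => f ((u : ℂ) + (v : ℂ) * Complex.I)) 2 volume :=
    ⟨(hf.comp (by fun_prop)).aestronglyMeasurable, hv.trans_lt ENNReal.ofReal_lt_top⟩
  have hK : MemLp (fun u : ℝ => ‖(u : ℂ) + (v : ℂ) * Complex.I - z‖⁻¹) 2 volume := by
    rw [memLp_two_iff_integrable_sq (Measurable.aestronglyMeasurable (by fun_prop))]
    simp_rw [norm_inv_sq_eq]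
    exact (integrable_inv_sq_add_sq hc).comp_sub_right z.re
  refine ⟨hF.norm.integrable_mul hK, ?_⟩
  have holder := integral_mul_le_Lp_mul_Lq_of_nonneg (μ := volume) Real.HolderConjugate.two_two
    (f := fun u : ℝ => ‖f ((u : ℂ) + (v : ℂ) * Complex.I)‖)
    (g := fun u : ℝ => ‖(u : ℂ) + (v : ℂ) * Complex.I - z‖⁻¹)
    (Filter.Eventually.of_forall fun _ => norm_nonneg _)
    (Filter.Eventually.of_forall fun _ => inv_nonneg.2 (norm_nonneg _))
    (by simpa using hF.norm) (by simpa using hK)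
  refine holder.trans ?_
  gcongr
  · rw [hF.eLpNorm_eq_integral_rpow_norm (by simp) (by simp),
      ENNReal.ofReal_le_ofReal_iff hM] at hv
    simpa using hv
  · simp_rw [Real.rpow_two, norm_inv_sq_eq]
    rw [integral_sub_right_eq_self (fun u : ℝ => (u ^ 2 + (v - z.im) ^ 2)⁻¹),
      integral_univ_inv_sq_add_sq hc, Real.mul_rpow Real.pi_nonneg (by positivity), Real.sqrt_eq_rpow,
      neg_div, Real.rpow_neg (abs_nonneg _), Real.inv_rpow (abs_nonneg _)]

theorem integral_indicator_rpow_abs {δ : ℝ} (hδ : 0 < δ) :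
    ∫ x : ℝ, (Set.Iic δ).indicator (fun r : ℝ => r ^ (-(1 : ℝ) / 2)) |x|
      = 4 * δ ^ ((1 : ℝ) / 2) := by
  rw [integral_comp_abs (f := (Set.Iic δ).indicator fun r : ℝ => r ^ (-(1 : ℝ) / 2)),
    setIntegral_indicator measurableSet_Iic, Set.Ioi_inter_Iic,
    ← intervalIntegral.integral_of_le hδ.le, integral_rpow (Or.inl (by norm_num))]
  norm_num
  ring

theorem integrable_indicator_rpow_abs {δ : ℝ} (hδ : 0 < δ) :
    Integrable fun x : ℝ => (Set.Iic δ).indicator (fun r : ℝ => r ^ (-(1 : ℝ) / 2)) |x| := by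
  by_contra h
  have := integral_indicator_rpow_abs hδ
  rw [integral_undef h] at this
  have : 0 < δ ^ ((1 : ℝ) / 2) := by positivity
  linarith

theorem rpow_neg_half_mul_le {δ r e : ℝ} (hδ : 0 < δ) (hr : 0 ≤ r) (he : 0 ≤ e) (he1 : e ≤ 1) :
    e * r ^ (-(1 : ℝ) / 2) ≤
      δ ^ (-(1 : ℝ) / 2) * e + (Set.Iic δ).indicator (fun r : ℝ => r ^ (-(1 : ℝ) / 2)) r := by
  by_cases h : r ≤ δ
  · rw [Set.indicator_of_mem (Set.mem_Iic.2 h)]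
    have h1 : 0 ≤ r ^ (-(1 : ℝ) / 2) := by positivity
    have h2 : 0 ≤ δ ^ (-(1 : ℝ) / 2) * e := by positivity
    nlinarith
  · rw [Set.indicator_of_notMem (by simpa using h), add_zero, mul_comm]
    exact mul_le_mul_of_nonneg_right
      (Real.rpow_le_rpow_of_nonpos hδ (not_le.1 h).le (by norm_num)) he

theorem stmt_16 :
    ∃ C > (0 : ℝ), ∀ f : ℂ → ℂ, Measurable f → ∀ M : ℝ, 0 ≤ M →
      (∀ v : ℝ, 0 < v →
        eLpNorm (fun u : ℝ => f ((u : ℂ) + (v : ℂ) * Complex.I)) 2 volume ≤ ENNReal.ofReal M) →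
      ∀ t : ℝ, 0 < t → ∀ z : ℂ,
        (∫ v in Set.Ioi (0 : ℝ), ∫ u in Set.Ioi v,
            ‖f ((u : ℂ) + (v : ℂ) * Complex.I)‖ * Real.exp (-8 * t * u * v) *
              ‖(u : ℂ) + (v : ℂ) * Complex.I - z‖⁻¹) ≤
          C * M * t ^ (-(1 : ℝ) / 4) := by
  refine ⟨√π * (√(π / 8) / 2 + 4), by positivity, fun f hf M hM hfM t ht z => ?_⟩
  set δ : ℝ := t ^ (-(1 : ℝ) / 2) with hδ_def
  have hδ : 0 < δ := by positivity
  set φ : ℝ → ℝ := fun v => (Set.Iic δ).indicator (fun r : ℝ => r ^ (-(1 : ℝ) / 2)) |v - z.im|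
    with hφ_def
  have hφ : Integrable φ := (integrable_indicator_rpow_abs hδ).comp_sub_right z.im
  have hφ0 : 0 ≤ φ := fun v =>
    Set.indicator_apply_nonneg fun _ => Real.rpow_nonneg (abs_nonneg _) _
  have hφ_int : ∫ v in Set.Ioi (0 : ℝ), φ v ≤ 4 * δ ^ ((1 : ℝ) / 2) := by
    refine (setIntegral_le_integral hφ (Filter.Eventually.of_forall hφ0)).trans_eq ?_
    rw [← integral_indicator_rpow_abs hδ]
    exact integral_sub_right_eq_self
      (fun v => (Set.Iic δ).indicator (fun r : ℝ => r ^ (-(1 : ℝ) / 2)) |v|) z.im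
  have hE : Integrable fun v : ℝ => Real.exp (-(8 * t) * v ^ 2) :=
    integrable_exp_neg_mul_sq (by positivity)
  have key : ∀ v : ℝ, 0 < v → v ≠ z.im →
      (∫ u in Set.Ioi v, ‖f ((u : ℂ) + (v : ℂ) * Complex.I)‖ * Real.exp (-8 * t * u * v) *
        ‖(u : ℂ) + (v : ℂ) * Complex.I - z‖⁻¹) ≤
      M * √π * (δ ^ (-(1 : ℝ) / 2) * Real.exp (-(8 * t) * v ^ 2) + φ v) := by
    intro v hv hvz
    obtain ⟨hint, hle⟩ := integral_norm_mul_cauchyKernel_le hf hM (hfM v hv) hvz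
    set G : ℝ → ℝ := fun u => ‖f ((u : ℂ) + (v : ℂ) * Complex.I)‖ *
      ‖(u : ℂ) + (v : ℂ) * Complex.I - z‖⁻¹
    have hG0 : 0 ≤ G := fun u => by positivity
    calc _ ≤ ∫ u in Set.Ioi v, Real.exp (-(8 * t) * v ^ 2) * G u := by
          refine integral_mono_of_nonneg (Filter.Eventually.of_forall fun u => by positivity)
            (hint.const_mul _).integrableOn
            ((ae_restrict_mem measurableSet_Ioi).mono fun u hu => ?_)
          have hu : v < u := hu
          have he : Real.exp (-8 * t * u * v) ≤ Real.exp (-(8 * t) * v ^ 2) := by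
            apply Real.exp_le_exp.2
            have : 0 ≤ t * v * (u - v) := by
              have := sub_pos.2 hu
              positivity
            nlinarith
          calc _ = Real.exp (-8 * t * u * v) * G u := by simp only [G]; ring
            _ ≤ _ := mul_le_mul_of_nonneg_right he (hG0 u)
      _ = Real.exp (-(8 * t) * v ^ 2) * ∫ u in Set.Ioi v, G u := integral_const_mul _ _
      _ ≤ Real.exp (-(8 * t) * v ^ 2) * (M * (√π * |v - z.im| ^ (-(1 : ℝ) / 2))) := by
          gcongr
          exact (setIntegral_le_integral hint (Filter.Eventually.of_forall hG0)).trans hle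
      _ = M * √π * (Real.exp (-(8 * t) * v ^ 2) * |v - z.im| ^ (-(1 : ℝ) / 2)) := by ring
      _ ≤ _ := by
          gcongr
          refine rpow_neg_half_mul_le hδ (abs_nonneg _) (Real.exp_nonneg _) ?_
          rw [Real.exp_le_one_iff]
          have : 0 ≤ t * v ^ 2 := by positivity
          linarith
  have hδ1 : δ ^ (-(1 : ℝ) / 2) = t ^ ((1 : ℝ) / 4) := by
    rw [hδ_def, ← Real.rpow_mul ht.le]
    norm_num
  have hδ2 : δ ^ ((1 : ℝ) / 2) = t ^ (-(1 : ℝ) / 4) := by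
    rw [hδ_def, ← Real.rpow_mul ht.le]
    norm_num
  have hsqrt : √(π / (8 * t)) = √(π / 8) * t ^ (-(1 : ℝ) / 2) := by
    rw [← div_div, Real.sqrt_div (by positivity), neg_div, Real.rpow_neg ht.le,
      ← Real.sqrt_eq_rpow, div_eq_mul_inv]
  have ht4 : t ^ ((1 : ℝ) / 4) * t ^ (-(1 : ℝ) / 2) = t ^ (-(1 : ℝ) / 4) := by
    rw [← Real.rpow_add ht]
    norm_num
  have hsum : IntegrableOn
      (fun v => δ ^ (-(1 : ℝ) / 2) * Real.exp (-(8 * t) * v ^ 2) + φ v) (Set.Ioi 0) :=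
    ((hE.const_mul _).add hφ).integrableOn
  calc _ ≤ ∫ v in Set.Ioi (0 : ℝ),
        M * √π * (δ ^ (-(1 : ℝ) / 2) * Real.exp (-(8 * t) * v ^ 2) + φ v) := by
        refine integral_mono_of_nonneg
          (Filter.Eventually.of_forall fun v => integral_nonneg fun u => by positivity)
          (hsum.const_mul _) ?_
        filter_upwards [ae_restrict_mem measurableSet_Ioi,
          ae_restrict_of_ae (Measure.ae_ne volume z.im)] with v hv hvz using key v hv hvz
    _ = M * √π * (δ ^ (-(1 : ℝ) / 2) * (√(π / (8 * t)) / 2) + ∫ v in Set.Ioi (0 : ℝ), φ v) := by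
        rw [integral_const_mul, integral_add (hE.const_mul _).integrableOn hφ.integrableOn,
          integral_const_mul, integral_gaussian_Ioi]
    _ ≤ M * √π * (δ ^ (-(1 : ℝ) / 2) * (√(π / (8 * t)) / 2) + 4 * δ ^ ((1 : ℝ) / 2)) := by
        gcongr
    _ = _ := by
        rw [hδ1, hδ2, hsqrt]
        linear_combination (M * √π * √(π / 8) / 2) * ht4
end

section
/- There exists an absolute constant C > 0 such that for all t > 0 and all z ∈ ℂ: ∫₀^∞ ∫_v^∞ (u² + v²)^{−1/4}·e^{−8t·u·v}·|u + iv − z|^{−1} du dv ≤ C·t^{−1/4}. -/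
open MeasureTheory Real Complex

theorem rpow_mul_rpow_le_add {x y a b : ℝ} (hx : 0 < x) (hy : 0 < y) (ha : a ≤ 0) (hb : b ≤ 0) :
    x ^ a * y ^ b ≤ x ^ (a + b) + y ^ (a + b) := by
  have hxp := rpow_nonneg hx.le (a + b)
  have hyp := rpow_nonneg hy.le (a + b)
  rcases le_total x y with h | h
  · have := mul_le_mul_of_nonneg_left (rpow_le_rpow_of_nonpos hx h hb) (rpow_nonneg hx.le a)
    rw [← rpow_add hx] at this
    linarith
  · have := mul_le_mul_of_nonneg_right (rpow_le_rpow_of_nonpos hy h ha) (rpow_nonneg hy.le b)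
    rw [← rpow_add hy] at this
    linarith

theorem integrable_comp_abs_sub {f : ℝ → ℝ} (hf : IntegrableOn f (Set.Ioi 0)) (c : ℝ) :
    Integrable (fun x => f |x - c|) := by
  have hg : Integrable ((Set.Ioi (0 : ℝ)).indicator f) := hf.integrable_indicator measurableSet_Ioi
  have h : Integrable (fun x => f |x|) := by
    refine (hg.add hg.comp_neg).congr ?_
    filter_upwards [Measure.ae_ne volume (0 : ℝ)] with x hx
    rcases lt_or_gt_of_ne hx with h | h
    · simp [Set.indicator, h, h.not_gt, abs_of_neg h]
    · simp [Set.indicator, h, h.not_gt, abs_of_pos h]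
  exact h.comp_sub_right c

theorem integral_comp_abs_sub (f : ℝ → ℝ) (c : ℝ) :
    ∫ x, f |x - c| = 2 * ∫ x in Set.Ioi (0 : ℝ), f x := by
  rw [integral_sub_right_eq_self (fun x => f |x|) c, integral_comp_abs]

/-- The power `y ^ p` truncated to `0 < y ≤ r`. -/
noncomputable def nearPow (p r : ℝ) : ℝ → ℝ := (Set.Ioc 0 r).indicator (fun y => y ^ p)

/-- The power `y ^ p` truncated to `r < y`. -/
noncomputable def farPow (p r : ℝ) : ℝ → ℝ := (Set.Ioi r).indicator (fun y => y ^ p)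

theorem nearPow_nonneg (p r y : ℝ) : 0 ≤ nearPow p r y :=
  Set.indicator_nonneg (fun _ hx => rpow_nonneg hx.1.le _) _

theorem farPow_nonneg (p : ℝ) {r : ℝ} (hr : 0 < r) (y : ℝ) : 0 ≤ farPow p r y :=
  Set.indicator_nonneg (fun _ hx => rpow_nonneg (hr.trans hx).le _) _

theorem integrable_nearPow {p r : ℝ} (hp : -1 < p) (hr : 0 < r) (c : ℝ) :
    Integrable (fun x => nearPow p r |x - c|) := by
  refine integrable_comp_abs_sub (Integrable.integrableOn ?_) c
  refine IntegrableOn.integrable_indicator ?_ measurableSet_Ioc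
  exact (intervalIntegrable_iff_integrableOn_Ioc_of_le hr.le).1
    (intervalIntegral.intervalIntegrable_rpow' hp)

theorem integral_nearPow {p r : ℝ} (hp : -1 < p) (hr : 0 < r) (c : ℝ) :
    ∫ x, nearPow p r |x - c| = 2 * (r ^ (p + 1) / (p + 1)) := by
  rw [integral_comp_abs_sub, nearPow, setIntegral_indicator measurableSet_Ioc,
    Set.inter_eq_right.2 Set.Ioc_subset_Ioi_self, ← intervalIntegral.integral_of_le hr.le,
    integral_rpow (Or.inl hp), zero_rpow (by linarith), sub_zero]

theorem integrable_farPow {p r : ℝ} (hp : p < -1) (hr : 0 < r) (c : ℝ) :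
    Integrable (fun x => farPow p r |x - c|) := by
  refine integrable_comp_abs_sub (Integrable.integrableOn ?_) c
  exact (integrableOn_Ioi_rpow_of_lt hp hr).integrable_indicator measurableSet_Ioi

theorem integral_farPow {p r : ℝ} (hp : p < -1) (hr : 0 < r) (c : ℝ) :
    ∫ x, farPow p r |x - c| = 2 * (-r ^ (p + 1) / (p + 1)) := by
  rw [integral_comp_abs_sub, farPow, setIntegral_indicator measurableSet_Ioi,
    Set.inter_eq_right.2 (Set.Ioi_subset_Ioi hr.le), integral_Ioi_rpow_of_lt hp hr]

/-- An integrable majorant of `u ^ (-1/2) * |u - a| ^ (-3/4)` on `u > v`. -/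
noncomputable def innerMajorant (v a u : ℝ) : ℝ :=
  v ^ (-(1 : ℝ) / 2) * nearPow (-(3 : ℝ) / 4) v |u - a| +
    (u ^ (-(5 : ℝ) / 4) + farPow (-(5 : ℝ) / 4) v |u - a|)

theorem le_innerMajorant {v a u : ℝ} (hv : 0 < v) (hu : v < u) (hua : u ≠ a) :
    u ^ (-(1 : ℝ) / 2) * |u - a| ^ (-(3 : ℝ) / 4) ≤ innerMajorant v a u := by
  have hpos : 0 < |u - a| := abs_pos.2 (sub_ne_zero.2 hua)
  have hu0 : 0 < u := hv.trans hu
  unfold innerMajorant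
  rcases le_or_gt |u - a| v with h | h
  · have h1 : nearPow (-(3 : ℝ) / 4) v |u - a| = |u - a| ^ (-(3 : ℝ) / 4) :=
      Set.indicator_of_mem (show |u - a| ∈ Set.Ioc 0 v from ⟨hpos, h⟩) _
    have h2 := farPow_nonneg (-(5 : ℝ) / 4) hv |u - a|
    have h3 := rpow_nonneg hu0.le (-(5 : ℝ) / 4)
    have h4 := mul_le_mul_of_nonneg_right
      (rpow_le_rpow_of_nonpos hv hu.le (by norm_num : -(1 : ℝ) / 2 ≤ 0))
      (rpow_nonneg hpos.le (-(3 : ℝ) / 4))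
    rw [h1]
    linarith
  · have h1 : farPow (-(5 : ℝ) / 4) v |u - a| = |u - a| ^ (-(5 : ℝ) / 4) :=
      Set.indicator_of_mem (show |u - a| ∈ Set.Ioi v from h) _
    have h2 := mul_nonneg (rpow_nonneg hv.le (-(1 : ℝ) / 2))
      (nearPow_nonneg (-(3 : ℝ) / 4) v |u - a|)
    have h3 := rpow_mul_rpow_le_add hu0 hpos (by norm_num : -(1 : ℝ) / 2 ≤ 0)
      (by norm_num : -(3 : ℝ) / 4 ≤ 0)
    rw [show -(1 : ℝ) / 2 + -(3 : ℝ) / 4 = -(5 : ℝ) / 4 by norm_num] at h3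
    rw [h1]
    linarith

theorem integrableOn_innerMajorant {v : ℝ} (hv : 0 < v) (a : ℝ) :
    IntegrableOn (innerMajorant v a) (Set.Ioi v) :=
  ((integrable_nearPow (by norm_num) hv a).const_mul _).integrableOn.add
    ((integrableOn_Ioi_rpow_of_lt (by norm_num) hv).add
      (integrable_farPow (by norm_num) hv a).integrableOn)

theorem integral_innerMajorant_le {v : ℝ} (hv : 0 < v) (a : ℝ) :
    ∫ u in Set.Ioi v, innerMajorant v a u ≤ 20 * v ^ (-(1 : ℝ) / 4) := by
  have hN := integrable_nearPow (p := -(3 : ℝ) / 4) (by norm_num) hv a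
  have hF := integrable_farPow (p := -(5 : ℝ) / 4) (by norm_num) hv a
  have hP := integrableOn_Ioi_rpow_of_lt (a := -(5 : ℝ) / 4) (by norm_num) hv
  have eN : ∫ u in Set.Ioi v, nearPow (-(3 : ℝ) / 4) v |u - a| ≤ 8 * v ^ ((1 : ℝ) / 4) := by
    refine (setIntegral_le_integral hN (.of_forall fun _ => nearPow_nonneg _ _ _)).trans_eq ?_
    rw [integral_nearPow (by norm_num) hv]
    norm_num
    ring
  have eF : ∫ u in Set.Ioi v, farPow (-(5 : ℝ) / 4) v |u - a| ≤ 8 * v ^ (-(1 : ℝ) / 4) := by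
    refine (setIntegral_le_integral hF (.of_forall fun _ => farPow_nonneg _ hv _)).trans_eq ?_
    rw [integral_farPow (by norm_num) hv]
    norm_num
    ring
  have eP : ∫ u in Set.Ioi v, u ^ (-(5 : ℝ) / 4) = 4 * v ^ (-(1 : ℝ) / 4) := by
    rw [integral_Ioi_rpow_of_lt (by norm_num) hv]
    norm_num
    ring
  have hmul := mul_le_mul_of_nonneg_left eN (rpow_nonneg hv.le (-(1 : ℝ) / 2))
  have hv2 : v ^ (-(1 : ℝ) / 2) * v ^ ((1 : ℝ) / 4) = v ^ (-(1 : ℝ) / 4) := by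
    rw [← rpow_add hv]
    norm_num
  have hPF : IntegrableOn
      (fun u => u ^ (-(5 : ℝ) / 4) + farPow (-(5 : ℝ) / 4) v |u - a|) (Set.Ioi v) :=
    hP.add hF.integrableOn
  unfold innerMajorant
  rw [integral_add (hN.const_mul _).integrableOn hPF,
    integral_add hP hF.integrableOn, integral_const_mul, eP]
  linarith

/-- An integrable majorant of `exp (-8 t v ^ 2) * |v - c| ^ (-1/2)`. -/
noncomputable def outerMajorant (t c v : ℝ) : ℝ :=
  nearPow (-(1 : ℝ) / 2) (t ^ (-(1 : ℝ) / 2)) |v - c| +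
    t ^ ((1 : ℝ) / 4) * Real.exp (-(8 * t) * v ^ 2)

theorem le_outerMajorant {t c v : ℝ} (ht : 0 < t) (hvc : v ≠ c) :
    Real.exp (-(8 * t) * v ^ 2) * |v - c| ^ (-(1 : ℝ) / 2) ≤ outerMajorant t c v := by
  have hpos : 0 < |v - c| := abs_pos.2 (sub_ne_zero.2 hvc)
  have hr : 0 < t ^ (-(1 : ℝ) / 2) := rpow_pos_of_pos ht _
  unfold outerMajorant
  rcases le_or_gt |v - c| (t ^ (-(1 : ℝ) / 2)) with h | h
  · have h1 : nearPow (-(1 : ℝ) / 2) (t ^ (-(1 : ℝ) / 2)) |v - c| = |v - c| ^ (-(1 : ℝ) / 2) :=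
      Set.indicator_of_mem (show |v - c| ∈ Set.Ioc 0 _ from ⟨hpos, h⟩) _
    have h2 : Real.exp (-(8 * t) * v ^ 2) ≤ 1 := Real.exp_le_one_iff.2 (by nlinarith [sq_nonneg v])
    have h3 := mul_le_of_le_one_left (rpow_nonneg hpos.le (-(1 : ℝ) / 2)) h2
    have h4 := mul_pos (rpow_pos_of_pos ht ((1 : ℝ) / 4)) (Real.exp_pos (-(8 * t) * v ^ 2))
    rw [h1]
    linarith
  · have h1 := rpow_le_rpow_of_nonpos hr h.le (by norm_num : -(1 : ℝ) / 2 ≤ 0)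
    rw [← rpow_mul ht.le, show -(1 : ℝ) / 2 * (-(1 : ℝ) / 2) = 1 / 4 by norm_num] at h1
    have h2 := mul_le_mul_of_nonneg_left h1 (Real.exp_pos (-(8 * t) * v ^ 2)).le
    have h3 := nearPow_nonneg (-(1 : ℝ) / 2) (t ^ (-(1 : ℝ) / 2)) |v - c|
    linarith

theorem integrable_outerMajorant {t : ℝ} (ht : 0 < t) (c : ℝ) :
    Integrable (outerMajorant t c) :=
  (integrable_nearPow (by norm_num) (rpow_pos_of_pos ht _) c).add
    ((integrable_exp_neg_mul_sq (by positivity)).const_mul _)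

theorem integral_outerMajorant_le {t : ℝ} (ht : 0 < t) (c : ℝ) :
    ∫ v in Set.Ioi (0 : ℝ), outerMajorant t c v ≤ 5 * t ^ (-(1 : ℝ) / 4) := by
  have hr : 0 < t ^ (-(1 : ℝ) / 2) := rpow_pos_of_pos ht _
  have hN := integrable_nearPow (p := -(1 : ℝ) / 2) (by norm_num) hr c
  have hG := (integrable_exp_neg_mul_sq (b := 8 * t) (by positivity)).const_mul (t ^ ((1 : ℝ) / 4))
  have eN : ∫ v in Set.Ioi (0 : ℝ), nearPow (-(1 : ℝ) / 2) (t ^ (-(1 : ℝ) / 2)) |v - c| ≤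
      4 * t ^ (-(1 : ℝ) / 4) := by
    refine (setIntegral_le_integral hN (.of_forall fun _ => nearPow_nonneg _ _ _)).trans_eq ?_
    rw [integral_nearPow (by norm_num) hr, ← rpow_mul ht.le]
    norm_num
    ring
  have hs : √(π / (8 * t)) ≤ t ^ (-(1 : ℝ) / 2) := by
    rw [show t ^ (-(1 : ℝ) / 2) = √(1 / t) by
      rw [sqrt_eq_rpow, one_div t, inv_rpow ht.le, ← rpow_neg ht.le]; norm_num]
    apply Real.sqrt_le_sqrt
    rw [div_le_div_iff₀ (by positivity) ht]
    nlinarith [Real.pi_le_four]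
  have ht2 : t ^ ((1 : ℝ) / 4) * t ^ (-(1 : ℝ) / 2) = t ^ (-(1 : ℝ) / 4) := by
    rw [← rpow_add ht]
    norm_num
  have hmul := mul_le_mul_of_nonneg_left hs (rpow_nonneg ht.le ((1 : ℝ) / 4))
  have hp := rpow_nonneg ht.le (-(1 : ℝ) / 4)
  unfold outerMajorant
  rw [integral_add hN.integrableOn hG.integrableOn, integral_const_mul, integral_gaussian_Ioi]
  linarith

theorem norm_inv_le_rpow_mul_rpow {w : ℂ} (hre : w.re ≠ 0) (him : w.im ≠ 0) :
    ‖w‖⁻¹ ≤ |w.re| ^ (-(3 : ℝ) / 4) * |w.im| ^ (-(1 : ℝ) / 4) := by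
  have hre' := abs_pos.2 hre
  have him' := abs_pos.2 him
  have hw : 0 < ‖w‖ := hre'.trans_le (abs_re_le_norm w)
  have h : ‖w‖⁻¹ = ‖w‖ ^ (-(3 : ℝ) / 4) * ‖w‖ ^ (-(1 : ℝ) / 4) := by
    rw [← rpow_add hw, ← rpow_neg_one]
    norm_num
  rw [h]
  exact mul_le_mul (rpow_le_rpow_of_nonpos hre' (abs_re_le_norm w) (by norm_num))
    (rpow_le_rpow_of_nonpos him' (abs_im_le_norm w) (by norm_num))
    (rpow_nonneg hw.le _) (rpow_nonneg hre'.le _)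

theorem integrand_le {t v u : ℝ} (ht : 0 < t) (hv : 0 < v) (hu : v < u) {z : ℂ}
    (hvz : v ≠ z.im) (huz : u ≠ z.re) :
    (u ^ 2 + v ^ 2) ^ (-(1 : ℝ) / 4) * Real.exp (-8 * t * u * v) *
        ‖(u : ℂ) + (v : ℂ) * Complex.I - z‖⁻¹ ≤
      Real.exp (-(8 * t) * v ^ 2) * |v - z.im| ^ (-(1 : ℝ) / 4) * innerMajorant v z.re u := by
  have hu0 : 0 < u := hv.trans hu
  have h1 : (u ^ 2 + v ^ 2) ^ (-(1 : ℝ) / 4) ≤ u ^ (-(1 : ℝ) / 2) := by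
    refine (rpow_le_rpow_of_nonpos (pow_pos hu0 2) (by nlinarith) (by norm_num)).trans_eq ?_
    rw [← rpow_natCast u 2, ← rpow_mul hu0.le]
    norm_num
  have h2 : Real.exp (-8 * t * u * v) ≤ Real.exp (-(8 * t) * v ^ 2) := by
    apply Real.exp_le_exp.2
    nlinarith [mul_pos (mul_pos ht hv) (sub_pos.2 hu)]
  have h3 : ‖(u : ℂ) + (v : ℂ) * Complex.I - z‖⁻¹ ≤
      |u - z.re| ^ (-(3 : ℝ) / 4) * |v - z.im| ^ (-(1 : ℝ) / 4) := by
    simpa using norm_inv_le_rpow_mul_rpow (w := (u : ℂ) + (v : ℂ) * Complex.I - z)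
      (by simpa using sub_ne_zero.2 huz) (by simpa using sub_ne_zero.2 hvz)
  calc _ ≤ u ^ (-(1 : ℝ) / 2) * Real.exp (-(8 * t) * v ^ 2) *
        (|u - z.re| ^ (-(3 : ℝ) / 4) * |v - z.im| ^ (-(1 : ℝ) / 4)) := by gcongr
    _ = Real.exp (-(8 * t) * v ^ 2) * |v - z.im| ^ (-(1 : ℝ) / 4) *
        (u ^ (-(1 : ℝ) / 2) * |u - z.re| ^ (-(3 : ℝ) / 4)) := by ring
    _ ≤ _ := by
      gcongr
      exact le_innerMajorant hv hu huz

theorem inner_integral_le {t v : ℝ} (ht : 0 < t) (hv : 0 < v) {z : ℂ} (hvz : v ≠ z.im) :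
    ∫ u in Set.Ioi v, (u ^ 2 + v ^ 2) ^ (-(1 : ℝ) / 4) * Real.exp (-8 * t * u * v) *
        ‖(u : ℂ) + (v : ℂ) * Complex.I - z‖⁻¹ ≤
      20 * (outerMajorant t 0 v + outerMajorant t z.im v) := by
  have hpos : 0 < |v - z.im| := abs_pos.2 (sub_ne_zero.2 hvz)
  calc _ ≤ ∫ u in Set.Ioi v, Real.exp (-(8 * t) * v ^ 2) * |v - z.im| ^ (-(1 : ℝ) / 4) *
        innerMajorant v z.re u := by
        refine integral_mono_of_nonneg (.of_forall fun u => by positivity)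
          ((integrableOn_innerMajorant hv z.re).const_mul _) ?_
        filter_upwards [ae_restrict_mem measurableSet_Ioi,
          ae_restrict_of_ae (Measure.ae_ne volume z.re)] with u hu huz
        exact integrand_le ht hv hu hvz huz
    _ ≤ Real.exp (-(8 * t) * v ^ 2) * |v - z.im| ^ (-(1 : ℝ) / 4) *
        (20 * v ^ (-(1 : ℝ) / 4)) := by
        rw [integral_const_mul]
        gcongr
        exact integral_innerMajorant_le hv z.re
    _ = 20 * (Real.exp (-(8 * t) * v ^ 2) *
        (v ^ (-(1 : ℝ) / 4) * |v - z.im| ^ (-(1 : ℝ) / 4))) := by ring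
    _ ≤ 20 * (Real.exp (-(8 * t) * v ^ 2) *
        (|v - 0| ^ (-(1 : ℝ) / 2) + |v - z.im| ^ (-(1 : ℝ) / 2))) := by
        have h := rpow_mul_rpow_le_add hv hpos (by norm_num : -(1 : ℝ) / 4 ≤ 0)
          (by norm_num : -(1 : ℝ) / 4 ≤ 0)
        rw [show -(1 : ℝ) / 4 + -(1 : ℝ) / 4 = -(1 : ℝ) / 2 by norm_num] at h
        rw [sub_zero, abs_of_pos hv]
        gcongr
    _ ≤ _ := by
        rw [mul_add (Real.exp _)]
        gcongr
        · exact le_outerMajorant ht hv.ne'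
        · exact le_outerMajorant ht hvz

theorem stmt_17 :
    ∃ C > (0 : ℝ), ∀ t : ℝ, 0 < t → ∀ z : ℂ,
      (∫ v in Set.Ioi (0 : ℝ), ∫ u in Set.Ioi v,
          (u ^ 2 + v ^ 2) ^ (-(1 : ℝ) / 4) * Real.exp (-8 * t * u * v) *
            ‖(u : ℂ) + (v : ℂ) * Complex.I - z‖⁻¹) ≤
        C * t ^ (-(1 : ℝ) / 4) := by
  refine ⟨200, by norm_num, fun t ht z => ?_⟩
  have h0 := (integrable_outerMajorant ht 0).integrableOn (s := Set.Ioi 0)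
  have hz := (integrable_outerMajorant ht z.im).integrableOn (s := Set.Ioi 0)
  calc _ ≤ ∫ v in Set.Ioi (0 : ℝ), 20 * (outerMajorant t 0 v + outerMajorant t z.im v) := by
        refine integral_mono_of_nonneg
          (.of_forall fun v => integral_nonneg fun u => by positivity)
          ((h0.add hz).const_mul 20) ?_
        filter_upwards [ae_restrict_mem measurableSet_Ioi,
          ae_restrict_of_ae (Measure.ae_ne volume z.im)] with v hv hvz
        exact inner_integral_le ht hv hvz
    _ ≤ 200 * t ^ (-(1 : ℝ) / 4) := by
        rw [integral_const_mul, integral_add h0 hz]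
        linarith [integral_outerMajorant_le ht 0, integral_outerMajorant_le ht z.im]
end

section
/- There exists an absolute constant C > 0 with the following property: for every measurable f : ℂ → ℂ such that M := sup_{v > 0} (∫_ℝ |f(u + iv)|² du)^{1/2} is finite, and for every t > 0: ∫₀^∞ ∫_v^∞ |f(u + iv)|·e^{−8t·u·v} du dv ≤ C·M·t^{−3/4}. -/
open MeasureTheory Real Complex

/-- Cauchy–Schwarz on the half-line `(v, ∞)` against an exponential weight. -/
lemma integral_Ioi_norm_mul_exp_le {g : ℝ → ℂ} (hg : Measurable g) {M : ℝ} (hM : 0 ≤ M)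
    (hgM : eLpNorm g 2 volume ≤ ENNReal.ofReal M) {a : ℝ} (ha : 0 < a) (v : ℝ) :
    ∫ u in Set.Ioi v, ‖g u‖ * Real.exp (-a * u) ≤
      M * (Real.exp (-(2 * a) * v) / (2 * a)) ^ (1 / 2 : ℝ) := by
  have hsq : ∀ u : ℝ, Real.exp (-a * u) ^ (2 : ℝ) = Real.exp (-(2 * a) * u) := fun u => by
    rw [← Real.exp_mul]
    ring_nf
  have hgR : eLpNorm g 2 (volume.restrict (Set.Ioi v)) ≤ ENNReal.ofReal M :=
    (eLpNorm_mono_measure g Measure.restrict_le_self).trans hgM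
  have hgL : MemLp g 2 (volume.restrict (Set.Ioi v)) :=
    ⟨hg.aestronglyMeasurable, hgR.trans_lt ENNReal.ofReal_lt_top⟩
  have heL : MemLp (fun u : ℝ => Real.exp (-a * u)) 2 (volume.restrict (Set.Ioi v)) := by
    rw [memLp_two_iff_integrable_sq (by fun_prop)]
    have h := integrableOn_exp_mul_Ioi (a := -(2 * a)) (by linarith) v
    refine h.congr (Filter.Eventually.of_forall fun u => ?_)
    simp only [← hsq, Real.rpow_two]
  have hnorm : (∫ u in Set.Ioi v, ‖g u‖ ^ (2 : ℝ)) ^ (1 / 2 : ℝ) ≤ M := by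
    rw [hgL.eLpNorm_eq_integral_rpow_norm (by norm_num) (by norm_num),
      ENNReal.ofReal_le_ofReal_iff hM] at hgR
    simpa using hgR
  have hint : ∫ u in Set.Ioi v, Real.exp (-a * u) ^ (2 : ℝ) =
      Real.exp (-(2 * a) * v) / (2 * a) := by
    simp only [hsq]
    rw [integral_exp_mul_Ioi (by linarith) v, neg_div_neg_eq]
  have hCS := integral_mul_le_Lp_mul_Lq_of_nonneg (μ := volume.restrict (Set.Ioi v))
    (f := fun u => ‖g u‖) (g := fun u => Real.exp (-a * u)) Real.HolderConjugate.two_two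
    (Filter.Eventually.of_forall fun u => norm_nonneg _)
    (Filter.Eventually.of_forall fun u => (Real.exp_pos _).le)
    (by simpa using hgL.norm) (by simpa using heL)
  rw [hint] at hCS
  exact hCS.trans (mul_le_mul_of_nonneg_right hnorm (by positivity))

theorem stmt_18 :
    ∃ C > (0 : ℝ), ∀ f : ℂ → ℂ, Measurable f → ∀ M : ℝ, 0 ≤ M →
      (∀ v : ℝ, 0 < v →
        eLpNorm (fun u : ℝ => f ((u : ℂ) + (v : ℂ) * Complex.I)) 2 volume ≤ ENNReal.ofReal M) →
      ∀ t : ℝ, 0 < t →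
        (∫ v in Set.Ioi (0 : ℝ), ∫ u in Set.Ioi v,
            ‖f ((u : ℂ) + (v : ℂ) * Complex.I)‖ * Real.exp (-8 * t * u * v)) ≤
          C * M * t ^ (-(3 : ℝ) / 4) := by
  have hΓ : 0 < Real.Gamma (1 / 4) := Real.Gamma_pos_of_pos (by norm_num)
  refine ⟨1 / 4 * ((8 : ℝ) ^ (-(1 / 4) : ℝ) * (1 / 2) * Real.Gamma (1 / 4)), by positivity,
    fun f hf M hM hfM t ht => ?_⟩
  have hbound : ∀ v ∈ Set.Ioi (0 : ℝ),
      (∫ u in Set.Ioi v, ‖f ((u : ℂ) + (v : ℂ) * Complex.I)‖ * Real.exp (-8 * t * u * v)) ≤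
        M * (1 / 4) * t ^ (-(1 / 2) : ℝ) *
          (v ^ (-(1 / 2) : ℝ) * Real.exp (-(8 * t) * v ^ (2 : ℝ))) := by
    intro v hv
    rw [Set.mem_Ioi] at hv
    have h := integral_Ioi_norm_mul_exp_le (g := fun u : ℝ => f ((u : ℂ) + (v : ℂ) * Complex.I))
      (hf.comp (by fun_prop)) hM (hfM v hv) (a := 8 * t * v) (by positivity) v
    convert h using 1
    · congr! 4
      ring
    · have h16 : (16 : ℝ) ^ (1 / 2 : ℝ) = 4 := by
        rw [← Real.sqrt_eq_rpow, show (16 : ℝ) = 4 ^ 2 by norm_num, Real.sqrt_sq (by norm_num)]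
      rw [show 2 * (8 * t * v) = 16 * (t * v) by ring, Real.div_rpow (by positivity)
        (by positivity), Real.mul_rpow (by norm_num) (by positivity),
        Real.mul_rpow ht.le hv.le, h16, ← Real.exp_mul, Real.rpow_neg ht.le, Real.rpow_neg hv.le,
        Real.rpow_two, show -(16 * (t * v)) * v * (1 / 2) = -(8 * t) * v ^ 2 by ring]
      field_simp
  have hmajor : IntegrableOn (fun v : ℝ => M * (1 / 4) * t ^ (-(1 / 2) : ℝ) *
      (v ^ (-(1 / 2) : ℝ) * Real.exp (-(8 * t) * v ^ (2 : ℝ)))) (Set.Ioi 0) :=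
    (integrableOn_rpow_mul_exp_neg_mul_rpow (by norm_num) (by norm_num)
      (by positivity)).const_mul _
  refine (integral_mono_of_nonneg (Filter.Eventually.of_forall fun v =>
    integral_nonneg fun u => by positivity) hmajor
    ((ae_restrict_mem measurableSet_Ioi).mono hbound)).trans_eq ?_
  rw [integral_const_mul,
    _root_.integral_rpow_mul_exp_neg_mul_rpow (by norm_num) (by norm_num)
    (by positivity), show (-(1 / 2) + 1 : ℝ) / 2 = 1 / 4 by norm_num,
    show -(-(1 / 2) + 1 : ℝ) / 2 = -(1 / 4) by norm_num, Real.mul_rpow (by norm_num) ht.le,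
    show -(3 : ℝ) / 4 = -(1 / 2) + -(1 / 4) by norm_num, Real.rpow_add ht]
  ring
end
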